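/- arXiv:math/0606325 — 2 statements merged into one kernel-verified Lean document; each statement's English description precedes it below -/
import Mathlib

section
/- Let n ≥ 2. The map L from Uℝⁿ to the set of 2-dimensional linear subspaces of ℝ^{n+3} that sends (x,ξ) to the span of γ₁(x,ξ) = (½(1+|x|²), ½(1−|x|²), x, 0) and γ₂(x,ξ) = (x·ξ, −x·ξ, ξ, 1) is injective: if (x,ξ), (x',ξ') ∈ Uℝⁿ and span{γ₁(x,ξ), γ₂(x,ξ)} = span{γ₁(x',ξ'), γ₂(x',ξ')}, then (x,ξ) = (x',ξ'). -/
open Matrix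

noncomputable section

/-- The row vector `(c0, c1, mid, clast)` in `ℝ^{n+3}`. -/
def emb (n : ℕ) (c0 c1 : ℝ) (mid : Fin n → ℝ) (clast : ℝ) : Fin (n + 3) → ℝ :=
  fun j =>
    if _h0 : j.val = 0 then c0
    else if _h1 : j.val = 1 then c1
    else if _h2 : j.val = n + 2 then clast
    else mid ⟨j.val - 2, by have := j.isLt; omega⟩

/-- The bilinear form `⟨X,Y⟩ = -X₁Y₁ + X₂Y₂ + ⋯ + X_{n+2}Y_{n+2} - X_{n+3}Y_{n+3}` of
signature `(n+1,2)` on `ℝ^{n+3}`. -/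
def form2 (n : ℕ) (X Y : Fin (n + 3) → ℝ) : ℝ :=
  ∑ i, (if i.val = 0 ∨ i.val = n + 2 then (-1 : ℝ) else 1) * X i * Y i

/-- `℘ = (1, -1, 0, …, 0, 0)`. -/
def wp (n : ℕ) : Fin (n + 3) → ℝ := emb n 1 (-1) 0 0

/-- Membership in `O(n+1,2)` (matrices acting on row vectors on the right). -/
def isO2 (n : ℕ) (T : Matrix (Fin (n + 3)) (Fin (n + 3)) ℝ) : Prop :=
  ∀ X Y : Fin (n + 3) → ℝ, form2 n (X ᵥ* T) (Y ᵥ* T) = form2 n X Y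

/-- `γ₁ = (½(1+|x|²), ½(1-|x|²), x, 0)`, the point-sphere coordinate of `(x,ξ)`. -/
def gamma1 (n : ℕ) (x : Fin n → ℝ) : Fin (n + 3) → ℝ :=
  emb n ((1 + x ⬝ᵥ x) / 2) ((1 - x ⬝ᵥ x) / 2) x 0

/-- `γ₂ = (x·ξ, -x·ξ, ξ, 1)`, the tangent-plane coordinate of `(x,ξ)`. -/
def gamma2 (n : ℕ) (x ξ : Fin n → ℝ) : Fin (n + 3) → ℝ :=
  emb n (x ⬝ᵥ ξ) (-(x ⬝ᵥ ξ)) ξ 1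

theorem emb_zero (n : ℕ) (c0 c1 : ℝ) (mid : Fin n → ℝ) (clast : ℝ) :
    emb n c0 c1 mid clast ⟨0, by omega⟩ = c0 := by
  simp [emb]

theorem emb_one (n : ℕ) (c0 c1 : ℝ) (mid : Fin n → ℝ) (clast : ℝ) :
    emb n c0 c1 mid clast ⟨1, by omega⟩ = c1 := by
  simp [emb]

theorem emb_last (n : ℕ) (c0 c1 : ℝ) (mid : Fin n → ℝ) (clast : ℝ) :
    emb n c0 c1 mid clast ⟨n + 2, by omega⟩ = clast := by
  simp [emb]

theorem emb_mid (n : ℕ) (c0 c1 : ℝ) (mid : Fin n → ℝ) (clast : ℝ) (i : Fin n) :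
    emb n c0 c1 mid clast ⟨i.val + 2, by omega⟩ = mid i := by
  simp [emb, i.isLt.ne]

/-- The middle coordinates of a vector lying in `span{γ₁(x,ξ), γ₂(x,ξ)}` are determined by its last
coordinate and the sum of its first two. -/
theorem emb_mid_of_mem_span {n : ℕ} {x ξ mid : Fin n → ℝ} {c0 c1 clast : ℝ}
    (h : emb n c0 c1 mid clast ∈ Submodule.span ℝ {gamma1 n x, gamma2 n x ξ}) :
    mid = (c0 + c1) • x + clast • ξ := by
  obtain ⟨a, b, hab⟩ := Submodule.mem_span_pair.1 h
  have h0 := congrFun hab ⟨0, by omega⟩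
  have h1 := congrFun hab ⟨1, by omega⟩
  have hl := congrFun hab ⟨n + 2, by omega⟩
  simp only [gamma1, gamma2, Pi.add_apply, Pi.smul_apply, smul_eq_mul, emb_zero, emb_one,
    emb_last] at h0 h1 hl
  have ha : c0 + c1 = a := by linarith
  have hb : clast = b := by linarith
  funext i
  have hi := congrFun hab ⟨i.val + 2, by omega⟩
  simp only [gamma1, gamma2, Pi.add_apply, Pi.smul_apply, smul_eq_mul, emb_mid] at hi
  simp only [Pi.add_apply, Pi.smul_apply, smul_eq_mul, ha, hb, hi]

/-- the Lie correspondence `(x,ξ) ↦ span{γ₁(x,ξ), γ₂(x,ξ)}` is injective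
on `Uℝⁿ`. -/
theorem stmt12 (n : ℕ) (hn : 2 ≤ n) (x ξ x' ξ' : Fin n → ℝ)
    (hξ : (∑ i, ξ i ^ 2) = 1) (hξ' : (∑ i, ξ' i ^ 2) = 1)
    (h : Submodule.span ℝ {gamma1 n x, gamma2 n x ξ}
        = Submodule.span ℝ {gamma1 n x', gamma2 n x' ξ'}) :
    x = x' ∧ ξ = ξ' := by
  have h1 : gamma1 n x ∈ Submodule.span ℝ {gamma1 n x', gamma2 n x' ξ'} :=
    h ▸ Submodule.subset_span (by simp)
  have h2 : gamma2 n x ξ ∈ Submodule.span ℝ {gamma1 n x', gamma2 n x' ξ'} :=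
    h ▸ Submodule.subset_span (by simp)
  have e1 := emb_mid_of_mem_span h1
  have e2 := emb_mid_of_mem_span h2
  rw [show (1 + x ⬝ᵥ x) / 2 + (1 - x ⬝ᵥ x) / 2 = 1 by ring, one_smul, zero_smul,
    add_zero] at e1
  rw [add_neg_cancel, zero_smul, one_smul, zero_add] at e2
  exact ⟨e1, e2⟩
end
end

section
/- Let n ≥ 2, p, p* ∈ ℝⁿ and r, r* ∈ ℝ, and define γ = (½(1+⟨p,p⟩+r²), ½(1−⟨p,p⟩−r²), −r, p) and γ* = (½(1+⟨p*,p*⟩+r*²), ½(1−⟨p*,p*⟩−r*²), −r*, p*) in ℝ^{n+3} (the Lorentzian sphere coordinates). Then ⟨γ,γ*⟩ = −½(⟨p−p*, p−p*⟩₁ + (r−r*)²), where ⟨·,·⟩₁ is the Lorentzian inner product on ℝⁿ. Moreover, if r ≠ r*, the oriented spheres H(p,r) and H(p*,r*) in Uℝⁿ₁ have a common point (are in oriented contact) if and only if ⟨γ,γ*⟩ = 0. -/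
open Matrix

noncomputable section

/-- The middle `n` coordinates `(-r, p₀)` of the Lorentzian sphere coordinate. -/
def midL (n : ℕ) (r : ℝ) (p₀ : Fin (n - 1) → ℝ) : Fin n → ℝ :=
  fun k =>
    if _h : k.val = 0 then -r
    else p₀ ⟨k.val - 1, by have := k.isLt; omega⟩

/-- The Lorentzian sphere coordinate
`γ = (½(1+⟨p,p⟩+r²), ½(1-⟨p,p⟩-r²), -r, p)` of `H(p,r)`, where `p = (p₀,p₁)` and
`⟨p,p⟩ = |p₀|² - p₁²`; the slot carrying `-r` is the third coordinate and the last
Lorentzian coordinate `p₁` occupies the final (negative) slot. -/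
def gammaL (n : ℕ) (p₀ : Fin (n - 1) → ℝ) (p₁ r : ℝ) : Fin (n + 3) → ℝ :=
  emb n ((1 + ((∑ i, p₀ i ^ 2) - p₁ ^ 2) + r ^ 2) / 2)
    ((1 - ((∑ i, p₀ i ^ 2) - p₁ ^ 2) - r ^ 2) / 2) (midL n r p₀) p₁

theorem form2_emb (n : ℕ) (a b d a' b' d' : ℝ) (u v : Fin n → ℝ) :
    form2 n (emb n a b u d) (emb n a' b' v d')
      = -(a * a') + b * b' + (∑ i, u i * v i) - d * d' := by
  unfold form2
  rw [Fin.sum_univ_succ, Fin.sum_univ_succ, Fin.sum_univ_castSucc]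
  have h : ∀ i : Fin n, (i : ℕ) ≠ n := fun i => i.isLt.ne
  simp [emb, h]
  ring

theorem sum_midL_mul (m : ℕ) (r s : ℝ) (p q : Fin m → ℝ) :
    ∑ i, midL (m + 1) r p i * midL (m + 1) s q i = r * s + ∑ i, p i * q i := by
  rw [Fin.sum_univ_succ]
  simp [midL]

theorem form2_gammaL (n : ℕ) (hn : 1 ≤ n) (p₀ q₀ : Fin (n - 1) → ℝ) (p₁ q₁ r s : ℝ) :
    form2 n (gammaL n p₀ p₁ r) (gammaL n q₀ q₁ s)
      = -((((∑ i, (p₀ i - q₀ i) ^ 2) - (p₁ - q₁) ^ 2) + (r - s) ^ 2) / 2) := by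
  obtain ⟨m, rfl⟩ := Nat.exists_eq_add_of_le' hn
  have h : ∑ i, (p₀ i - q₀ i) ^ 2
      = (∑ i, p₀ i ^ 2) - 2 * (∑ i, p₀ i * q₀ i) + ∑ i, q₀ i ^ 2 := by
    rw [Finset.mul_sum, ← Finset.sum_sub_distrib, ← Finset.sum_add_distrib]
    exact Finset.sum_congr rfl fun i _ => by ring
  rw [h]
  unfold gammaL
  have hmid : ∑ i, midL (m + 1) r p₀ i * midL (m + 1) s q₀ i = r * s + ∑ i, p₀ i * q₀ i :=
    sum_midL_mul m r s p₀ q₀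
  rw [form2_emb, hmid]
  ring

/-- `⟨γ,γ*⟩ = -½(⟨p-p*,p-p*⟩₁ + (r-r*)²)`, and for `r ≠ r*` the
oriented spheres `H(p,r)`, `H(p*,r*)` of `Uℝⁿ₁` have a common point iff
`⟨γ,γ*⟩ = 0`. -/
theorem stmt18 (n : ℕ) (hn : 2 ≤ n) (p₀ q₀ : Fin (n - 1) → ℝ) (p₁ q₁ r s : ℝ) :
    form2 n (gammaL n p₀ p₁ r) (gammaL n q₀ q₁ s)
      = -((((∑ i, (p₀ i - q₀ i) ^ 2) - (p₁ - q₁) ^ 2) + (r - s) ^ 2) / 2) ∧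
    (r ≠ s →
      ((∃ (x₀ ξ₀ : Fin (n - 1) → ℝ) (x₁ ξ₁ : ℝ),
          (∑ i, ξ₀ i ^ 2) - ξ₁ ^ 2 = -1 ∧
          x₀ - p₀ = r • ξ₀ ∧ x₁ - p₁ = r * ξ₁ ∧
          x₀ - q₀ = s • ξ₀ ∧ x₁ - q₁ = s * ξ₁)
        ↔ form2 n (gammaL n p₀ p₁ r) (gammaL n q₀ q₁ s) = 0)) := by
  refine ⟨form2_gammaL n (by omega) p₀ q₀ p₁ q₁ r s, fun hrs => ?_⟩
  rw [form2_gammaL n (by omega)]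
  constructor
  · rintro ⟨x₀, ξ₀, x₁, ξ₁, hξ, hp₀, hp₁, hq₀, hq₁⟩
    have h₀ : ∀ i, (p₀ i - q₀ i) ^ 2 = (s - r) ^ 2 * ξ₀ i ^ 2 := fun i => by
      have hp := congrFun hp₀ i
      have hq := congrFun hq₀ i
      simp only [Pi.sub_apply, Pi.smul_apply, smul_eq_mul] at hp hq
      rw [show p₀ i - q₀ i = (s - r) * ξ₀ i by linarith]
      ring
    rw [Finset.sum_congr rfl fun i _ => h₀ i, ← Finset.mul_sum,
      show p₁ - q₁ = (s - r) * ξ₁ by linarith]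
    linear_combination (-(s - r) ^ 2 / 2) * hξ
  · intro h
    have hsr : s - r ≠ 0 := sub_ne_zero.mpr hrs.symm
    refine ⟨fun i => p₀ i + r * ((p₀ i - q₀ i) / (s - r)), fun i => (p₀ i - q₀ i) / (s - r),
      p₁ + r * ((p₁ - q₁) / (s - r)), (p₁ - q₁) / (s - r), ?_, ?_, ?_, ?_, ?_⟩
    · simp only [div_pow]
      rw [← Finset.sum_div]
      field_simp
      linear_combination -2 * h
    · ext i
      simp
    · ring
    · ext i
      simp only [Pi.sub_apply, Pi.smul_apply, smul_eq_mul]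
      field_simp
      ring
    · field_simp
      ring
end
end
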